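/- arXiv:1806.04090 — 7 statements merged into one kernel-verified Lean document; each statement's English description precedes it below -/
import Mathlib

section
/- Let λ ∈ ℝ^n, let 0 < s ≤ n, and suppose λ is s-unbalanced at index j, i.e., |λ_j| s > ‖λ‖₁. Let q ∈ ℝ^n be feasible, i.e., 0 < q_i ≤ 1 for all i and Σ_i q_i = s. Then there exists p ∈ ℝ^n feasible (0 < p_i ≤ 1 for all i and Σ_i p_i = s) with p_j = 1 and Σ_{i=1}^n λ_i²/p_i ≤ Σ_{i=1}^n λ_i²/q_i. -/
/-- Decreasing a weight from `q` to `p` costs at most `c ^ 2` per unit of mass. -/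
theorem sq_div_le_of_sq_le {x c p q : ℝ} (hp : 0 < p) (hpq : p ≤ q)
    (h : x ^ 2 ≤ c ^ 2 * (p * q)) : x ^ 2 / p ≤ x ^ 2 / q + c ^ 2 * (q - p) := by
  have hq : 0 < q := hp.trans_le hpq
  have hdiff : x ^ 2 / p - x ^ 2 / q = x ^ 2 / (p * q) * (q - p) := by
    field_simp
  have hcoef : x ^ 2 / (p * q) ≤ c ^ 2 := by
    rwa [div_le_iff₀ (mul_pos hp hq)]
  linarith [mul_le_mul_of_nonneg_right hcoef (sub_nonneg.2 hpq)]

/-- Increasing a weight from `q` to `1` gains at least `c ^ 2` per unit of mass. -/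
theorem sq_le_sq_div_add {c q : ℝ} (hq : 0 < q) :
    c ^ 2 ≤ c ^ 2 / q + c ^ 2 * (q - 1) := by
  have hgap : c ^ 2 / q + c ^ 2 * (q - 1) - c ^ 2 = c ^ 2 * (1 - q) ^ 2 / q := by
    field_simp
    ring
  have : 0 ≤ c ^ 2 * (1 - q) ^ 2 / q := by positivity
  linarith

/-- **Lemma 4 (unbalanced case).** If `λ` is `s`-unbalanced at index `j`
(`|λ j| * s > ‖λ‖₁`) and `q` is feasible (`0 < q i ≤ 1`, `∑ i, q i = s`), then there is
a feasible `p` with `p j = 1` and `f(p) ≤ f(q)`, where `f(p) = ∑ i, λ i ^ 2 / p i`. -/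
theorem atomo_unbalanced_set_to_one
    {n : ℕ} (lam : Fin n → ℝ) (s : ℝ) (hs0 : 0 < s) (hsn : s ≤ n)
    (j : Fin n) (hj : (∑ i, |lam i|) < |lam j| * s)
    (q : Fin n → ℝ) (hq : ∀ i, 0 < q i ∧ q i ≤ 1) (hqsum : ∑ i, q i = s) :
    ∃ p : Fin n → ℝ, (∀ i, 0 < p i ∧ p i ≤ 1) ∧ (∑ i, p i) = s ∧ p j = 1 ∧
      (∑ i, (lam i) ^ 2 / p i) ≤ ∑ i, (lam i) ^ 2 / q i := by
  have hc : 0 < |lam j| := by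
    have h0 : 0 ≤ ∑ i, |lam i| := Finset.sum_nonneg fun i _ => abs_nonneg _
    exact pos_of_mul_pos_left (h0.trans_lt hj) hs0.le
  set a : Fin n → ℝ := fun i => |lam i| / |lam j| with ha
  set d : Fin n → ℝ := fun i => max (q i - a i) 0 with hd
  have ha0 : ∀ i, 0 ≤ a i := fun i => by positivity
  have haj : a j = 1 := div_self hc.ne'
  have hlam : ∀ i, lam i ^ 2 = lam j ^ 2 * a i ^ 2 := fun i => by
    rw [ha, div_pow, sq_abs, sq_abs, mul_div_cancel₀ _ (pow_ne_zero 2 (abs_pos.1 hc))]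
  have hd0 : ∀ i, 0 ≤ d i := fun i => le_max_right _ _
  have hdj : d j = 0 := max_eq_right (by linarith [(hq j).2])
  have hdq : ∀ i, d i ≤ q i := fun i => max_le (by linarith [ha0 i]) (hq i).1.le
  have hasum : ∑ i, a i < s := by
    rw [ha, ← Finset.sum_div, div_lt_iff₀ hc]
    linarith
  have hD : 1 - q j < ∑ i, d i := by
    have hle : d j - (q j - a j) ≤ ∑ i, (d i - (q i - a i)) :=
      Finset.single_le_sum (f := fun i => d i - (q i - a i))
        (fun i _ => sub_nonneg.2 (le_max_left _ _)) (Finset.mem_univ j)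
    rw [Finset.sum_sub_distrib, Finset.sum_sub_distrib] at hle
    linarith
  have hqj : 0 ≤ 1 - q j := sub_nonneg.2 (hq j).2
  have hDpos : 0 < ∑ i, d i := hqj.trans_lt hD
  obtain ⟨t, ht0, ht1, ht⟩ : ∃ t : ℝ, 0 ≤ t ∧ t < 1 ∧ t * ∑ i, d i = 1 - q j :=
    ⟨(1 - q j) / ∑ i, d i, by positivity, (div_lt_one hDpos).2 hD,
      div_mul_cancel₀ _ hDpos.ne'⟩
  set p : Fin n → ℝ := fun i => q i - t * d i + if i = j then 1 - q j else 0 with hp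
  have hpj : p j = 1 := by simp [hp, hdj]
  have hpi : ∀ i, i ≠ j → p i = q i - t * d i := fun i hi => by simp [hp, hi]
  have hpsum : ∑ i, p i = s := by
    simp only [hp, Finset.sum_add_distrib, Finset.sum_sub_distrib, ← Finset.mul_sum,
      Finset.sum_ite_eq', Finset.mem_univ, if_true]
    linarith
  have htd : ∀ i, 0 ≤ t * d i := fun i => mul_nonneg ht0 (hd0 i)
  have hpos : ∀ i, 0 < q i - t * d i := fun i => by
    nlinarith [hdq i, hd0 i, (hq i).1]
  refine ⟨p, fun i => ?_, hpsum, hpj, ?_⟩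
  · rcases eq_or_ne i j with rfl | hi
    · simp [hpj]
    · rw [hpi i hi]
      exact ⟨hpos i, by linarith [htd i, (hq i).2]⟩
  · have hterm : ∀ i, lam i ^ 2 / p i ≤ lam i ^ 2 / q i + lam j ^ 2 * (q i - p i) := by
      intro i
      rcases eq_or_ne i j with rfl | hi
      · rw [hpj, div_one]
        exact sq_le_sq_div_add (hq i).1
      · rw [hpi i hi]
        rcases le_total (q i) (a i) with h | h
        · have : d i = 0 := max_eq_right (sub_nonpos.2 h)
          simp [this]
        · have hdi : d i = q i - a i := max_eq_left (sub_nonneg.2 h)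
          refine sq_div_le_of_sq_le (hpos i) (by linarith [htd i]) ?_
          have hap : a i ≤ q i - t * d i := by nlinarith [hd0 i]
          rw [hlam i, sq (a i)]
          exact mul_le_mul_of_nonneg_left
            (mul_le_mul hap h (ha0 i) (hpos i).le) (sq_nonneg _)
    calc ∑ i, lam i ^ 2 / p i
        ≤ ∑ i, (lam i ^ 2 / q i + lam j ^ 2 * (q i - p i)) :=
          Finset.sum_le_sum fun i _ => hterm i
      _ = ∑ i, lam i ^ 2 / q i := by
          rw [Finset.sum_add_distrib, ← Finset.mul_sum, Finset.sum_sub_distrib, hqsum, hpsum,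
            sub_self, mul_zero, add_zero]
end

section
/- Let λ ∈ ℝ^n, let 0 < s ≤ n, and suppose λ is s-unbalanced, i.e., there exists j with |λ_j| s > ‖λ‖₁. Then for every p ∈ ℝ^n with 0 < p_i ≤ 1 for all i and Σ_i p_i = s, it holds that Σ_{i=1}^n λ_i²/p_i > (1/s)‖λ‖₁². -/
/-- The tangent-line gap of `a ^ 2 / x` is a square divided by `x`. -/
lemma sq_div_sub_tangent (a c : ℝ) {x : ℝ} (hx : x ≠ 0) :
    a ^ 2 / x - (2 * c * |a| - c ^ 2 * x) = (|a| - c * x) ^ 2 / x := by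
  rw [← sq_abs a]
  field_simp
  ring

/-- **Theorem 1, part 2 (strict inequality in the unbalanced case).** If `λ` is
`s`-unbalanced (there is `j` with `|λ j| * s > ‖λ‖₁`), then every feasible `p`
(`0 < p i ≤ 1`, `∑ i, p i = s`) satisfies `∑ i, λ i ^ 2 / p i > (1/s) * ‖λ‖₁ ^ 2`. -/
theorem atomo_unbalanced_strict
    {n : ℕ} (lam : Fin n → ℝ) (s : ℝ) (hs0 : 0 < s) (hsn : s ≤ n)
    (hub : ∃ j, (∑ i, |lam i|) < |lam j| * s) :
    ∀ p : Fin n → ℝ, (∀ i, 0 < p i ∧ p i ≤ 1) → (∑ i, p i) = s →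
      (1 / s) * (∑ i, |lam i|) ^ 2 < ∑ i, (lam i) ^ 2 / p i := by
  intro p hp hsum
  obtain ⟨j, hj⟩ := hub
  set L := ∑ i, |lam i| with hL
  have hc0 : 0 ≤ L / s := div_nonneg (Finset.sum_nonneg fun i _ => abs_nonneg _) hs0.le
  have hcj : L / s < |lam j| := (div_lt_iff₀ hs0).2 hj
  have hlt : ∑ i, (2 * (L / s) * |lam i| - (L / s) ^ 2 * p i) < ∑ i, (lam i) ^ 2 / p i := by
    refine Finset.sum_lt_sum (fun i _ => ?_) ⟨j, Finset.mem_univ j, ?_⟩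
    · have h := sq_div_sub_tangent (lam i) (L / s) (hp i).1.ne'
      have := div_nonneg (sq_nonneg (|lam i| - L / s * p i)) (hp i).1.le
      linarith
    · have h := sq_div_sub_tangent (lam j) (L / s) (hp j).1.ne'
      have hgap : 0 < |lam j| - L / s * p j := by
        linarith [mul_le_of_le_one_right hc0 (hp j).2]
      have := div_pos (pow_pos hgap 2) (hp j).1
      linarith
  rw [Finset.sum_sub_distrib, ← Finset.mul_sum, ← Finset.mul_sum, hsum, ← hL] at hlt
  convert hlt using 1
  field_simp
  ring
end

section
/- Let λ ∈ ℝ^n with λ_i ≠ 0 for all i, let 0 < s ≤ n, suppose λ is s-unbalanced (|λ_i| s > ‖λ‖₁ for some i), and let j be an index with |λ_j| = max_i |λ_i|. Then there exists a feasible p ∈ ℝ^n (0 < p_i ≤ 1 for all i, Σ_i p_i = s) with p_j = 1 such that Σ_{i=1}^n λ_i²/p_i ≤ Σ_{i=1}^n λ_i²/q_i for every feasible q ∈ ℝ^n; that is, the minimum of f over the feasible set is attained at some p with p_j = 1. -/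
/-- The tangent-line bound at the truncated value `min 1 (t * a)` with common multiplier
`1 / t ^ 2`. -/
lemma sq_div_min_one_mul_sub_le (a : ℝ) {t q : ℝ} (ht : 0 < t) (hq : 0 < q)
    (hq1 : q ≤ 1) :
    a ^ 2 / min 1 (t * a) - (q - min 1 (t * a)) / t ^ 2 ≤ a ^ 2 / q := by
  rcases le_total 1 (t * a) with h | h
  · rw [min_eq_left h, div_one]
    have h1 : (1 - q) / t ^ 2 ≤ (1 - q) * a ^ 2 := by
      rw [div_le_iff₀ (by positivity)]
      nlinarith [mul_nonneg (sub_nonneg.2 hq1) (by nlinarith : 0 ≤ (t * a) ^ 2 - 1)]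
    have h2 : a ^ 2 + (1 - q) * a ^ 2 ≤ a ^ 2 / q := by
      rw [le_div_iff₀ hq]
      nlinarith [mul_nonneg (sq_nonneg a) (sq_nonneg (1 - q))]
    have h3 : (q - 1) / t ^ 2 = -((1 - q) / t ^ 2) := by ring
    linarith
  · rw [min_eq_right h]
    have key : a ^ 2 / q - (a ^ 2 / (t * a) - (q - t * a) / t ^ 2) = (a - q / t) ^ 2 / q := by
      field_simp
      ring
    have : 0 ≤ (a - q / t) ^ 2 / q := by positivity
    linarith

/-- The truncated weights `min 1 (t * a i)` attain every total `s` with `0 < s ≤ card ι`. -/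
lemma exists_sum_min_one_mul_eq {ι : Type*} [Fintype ι] {a : ι → ℝ} (ha : ∀ i, 0 < a i)
    {s : ℝ} (hs0 : 0 < s) (hs : s ≤ Fintype.card ι) :
    ∃ t, 0 < t ∧ ∑ i, min 1 (t * a i) = s := by
  have hT : 0 ≤ ∑ i, (a i)⁻¹ := Finset.sum_nonneg fun i _ => (inv_pos.2 (ha i)).le
  have hend : ∑ i, min 1 ((∑ k, (a k)⁻¹) * a i) = Fintype.card ι := by
    have h (i : ι) : min 1 ((∑ k, (a k)⁻¹) * a i) = 1 := by
      refine min_eq_left ?_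
      rw [← div_le_iff₀ (ha i), one_div]
      exact Finset.single_le_sum (f := fun k => (a k)⁻¹)
        (fun k _ => (inv_pos.2 (ha k)).le) (Finset.mem_univ i)
    simp [h]
  have hcont : Continuous fun t : ℝ => ∑ i, min 1 (t * a i) := by fun_prop
  obtain ⟨t, ht, hts⟩ := intermediate_value_Icc hT hcont.continuousOn
    (show s ∈ Set.Icc _ _ from ⟨by simpa using hs0.le, by rw [hend]; exact hs⟩)
  refine ⟨t, ht.1.lt_of_ne ?_, hts⟩
  rintro rfl
  simp at hts
  exact hs0.ne hts

/-- **Theorem 1, part 2 (minimizer structure in the unbalanced case).** If all `λ i ≠ 0`,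
`0 < s ≤ n`, `λ` is `s`-unbalanced, and `j` maximizes `|λ i|`, then the minimum of
`f(p) = ∑ i, λ i ^ 2 / p i` over the feasible set is attained at some `p` with `p j = 1`. -/
theorem atomo_unbalanced_min_at_one
    {n : ℕ} (lam : Fin n → ℝ) (hlam : ∀ i, lam i ≠ 0)
    (s : ℝ) (hs0 : 0 < s) (hsn : s ≤ n)
    (hub : ∃ i, (∑ k, |lam k|) < |lam i| * s)
    (j : Fin n) (hj : ∀ i, |lam i| ≤ |lam j|) :
    ∃ p : Fin n → ℝ, (∀ i, 0 < p i ∧ p i ≤ 1) ∧ (∑ i, p i) = s ∧ p j = 1 ∧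
      ∀ q : Fin n → ℝ, (∀ i, 0 < q i ∧ q i ≤ 1) → (∑ i, q i) = s →
        (∑ i, (lam i) ^ 2 / p i) ≤ ∑ i, (lam i) ^ 2 / q i := by
  have ha : ∀ i, 0 < |lam i| := fun i => abs_pos.2 (hlam i)
  obtain ⟨t, ht, hts⟩ := exists_sum_min_one_mul_eq ha hs0 (by simpa using hsn)
  refine ⟨fun i => min 1 (t * |lam i|),
    fun i => ⟨lt_min one_pos (mul_pos ht (ha i)), min_le_left _ _⟩, hts, ?_, ?_⟩
  · refine min_eq_left ?_
    by_contra! hlt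
    obtain ⟨i, hi⟩ := hub
    have hsum : s = t * ∑ k, |lam k| := by
      rw [← hts, Finset.mul_sum]
      exact Finset.sum_congr rfl fun k _ =>
        min_eq_right ((mul_le_mul_of_nonneg_left (hj k) ht.le).trans hlt.le)
    have h1 : ∑ k, |lam k| < |lam j| * s :=
      hi.trans_le (mul_le_mul_of_nonneg_right (hj i) hs0.le)
    nlinarith [mul_lt_mul_of_pos_left h1 ht, mul_lt_mul_of_pos_right hlt hs0]
  · intro q hq hqs
    have h := Finset.sum_le_sum fun i (_ : i ∈ Finset.univ) =>
      sq_div_min_one_mul_sub_le |lam i| ht (hq i).1 (hq i).2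
    simp only [sq_abs] at h
    rw [Finset.sum_sub_distrib, ← Finset.sum_div, Finset.sum_sub_distrib, hqs, hts, sub_self,
      zero_div, sub_zero] at h
    exact h
end

section
/- Let g ∈ ℝ^n with g_i ≠ 0 for all i, let q ≥ 1 be a real number, set ‖g‖_q = (Σ_{i=1}^n |g_i|^q)^{1/q}, ‖g‖₁ = Σ_{i=1}^n |g_i|, and s = ‖g‖₁/‖g‖_q. Define p_i = |g_i|/‖g‖_q. Then p is feasible for budget s (0 < p_i ≤ 1 for all i, Σ_i p_i = s), Σ_{i=1}^n g_i²/p_i = ‖g‖₁‖g‖_q, and for every p' ∈ ℝ^n with 0 < p'_i ≤ 1 for all i and Σ_i p'_i = s it holds that Σ_{i=1}^n g_i²/p'_i ≥ ‖g‖₁‖g‖_q; i.e., p solves the variance-minimization problem for sparsity budget s. -/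
theorem abs_le_sum_abs_rpow {ι : Type*} [Fintype ι] (g : ι → ℝ) {q : ℝ} (hq : 0 < q)
    (i : ι) : |g i| ≤ (∑ j, |g j| ^ q) ^ (1 / q) := by
  rw [one_div, Real.le_rpow_inv_iff_of_pos (abs_nonneg _)
    (Finset.sum_nonneg fun j _ => Real.rpow_nonneg (abs_nonneg _) _) hq]
  exact Finset.single_le_sum (f := fun j => |g j| ^ q)
    (fun j _ => Real.rpow_nonneg (abs_nonneg _) _) (Finset.mem_univ i)

theorem sq_div_div_eq_mul {K : Type*} [Field K] (a c : K) : a ^ 2 / (a / c) = a * c := by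
  rcases eq_or_ne a 0 with rfl | ha
  · simp
  · rw [div_div_eq_mul_div]
    field_simp

/-- **Theorem 2 (optimality of ℓ_q-quantization).** For `g` with all entries nonzero and
`q ≥ 1`, set `‖g‖_q = (∑ j, |g j| ^ q) ^ (1/q)` and `s = ‖g‖₁ / ‖g‖_q`. The probabilities
`p i = |g i| / ‖g‖_q` are feasible for budget `s`, achieve
`∑ i, g i ^ 2 / p i = ‖g‖₁ * ‖g‖_q`, and minimize `∑ i, g i ^ 2 / p' i` over all
feasible `p'`. -/
theorem lq_quantization_optimal
    {n : ℕ} (g : Fin n → ℝ) (hg : ∀ i, g i ≠ 0) (q : ℝ) (hq : 1 ≤ q) :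
    (∀ i, 0 < |g i| / (∑ j, |g j| ^ q) ^ (1 / q)
        ∧ |g i| / (∑ j, |g j| ^ q) ^ (1 / q) ≤ 1)
    ∧ (∑ i, |g i| / (∑ j, |g j| ^ q) ^ (1 / q))
        = (∑ j, |g j|) / (∑ j, |g j| ^ q) ^ (1 / q)
    ∧ (∑ i, (g i) ^ 2 / (|g i| / (∑ j, |g j| ^ q) ^ (1 / q)))
        = (∑ j, |g j|) * (∑ j, |g j| ^ q) ^ (1 / q)
    ∧ ∀ p' : Fin n → ℝ, (∀ i, 0 < p' i ∧ p' i ≤ 1) →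
        (∑ i, p' i) = (∑ j, |g j|) / (∑ j, |g j| ^ q) ^ (1 / q) →
        (∑ j, |g j|) * (∑ j, |g j| ^ q) ^ (1 / q) ≤ ∑ i, (g i) ^ 2 / p' i := by
  have hle := abs_le_sum_abs_rpow g (zero_lt_one.trans_le hq)
  generalize (∑ j, |g j| ^ q) ^ (1 / q) = N at *
  have hN (i : Fin n) : 0 < N := (abs_pos.2 (hg i)).trans_le (hle i)
  refine ⟨fun i => ⟨div_pos (abs_pos.2 (hg i)) (hN i), (div_le_one (hN i)).2 (hle i)⟩,
    (Finset.sum_div ..).symm, ?_, fun p' hp' hsum => ?_⟩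
  · rw [Finset.sum_mul]
    refine Finset.sum_congr rfl fun i _ => ?_
    rw [← sq_abs, sq_div_div_eq_mul]
  · have h := Finset.sq_sum_div_le_sum_sq_div Finset.univ (fun i => |g i|)
      (fun i _ => (hp' i).1)
    simpa only [hsum, sq_div_div_eq_mul, sq_abs] using h
end

section
/- Let X be a real n×m matrix written as X = Σ_{i=1}^r σ_i u_i v_iᵀ where each σ_i ≥ 0, {u_1,…,u_r} is an orthonormal family in ℝ^n, and {v_1,…,v_r} is an orthonormal family in ℝ^m. Then Σ_{i=1}^r σ_i ≤ Σ_{i,j} |X_{ij}|; that is, ‖X‖_* ≤ ‖X‖_{1,1}. -/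
/-- Bessel's inequality for the coordinate vectors: the `i`-th coordinates of an orthonormal
family have sum of squares at most one. -/
theorem sum_sq_coord_le_one_of_orthonormal {ι κ : Type*} [Fintype ι] [Fintype κ] [DecidableEq κ]
    (u : κ → ι → ℝ) (hu : ∀ k l, (∑ i, u k i * u l i) = if k = l then 1 else 0) (i : ι) :
    ∑ k, u k i ^ 2 ≤ 1 := by
  set P := ∑ k, u k i ^ 2 with hP
  have hnorm : ∑ j, (∑ k, u k i * u k j) ^ 2 = P := by
    calc ∑ j, (∑ k, u k i * u k j) ^ 2
        = ∑ j, ∑ k, ∑ l, u k i * u l i * (u k j * u l j) := by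
          refine Finset.sum_congr rfl fun j _ => ?_
          rw [sq, Finset.sum_mul_sum]
          exact Finset.sum_congr rfl fun k _ => Finset.sum_congr rfl fun l _ => by ring
      _ = ∑ k, ∑ l, u k i * u l i * ∑ j, u k j * u l j := by
          rw [Finset.sum_comm]
          refine Finset.sum_congr rfl fun k _ => ?_
          rw [Finset.sum_comm]
          simp only [Finset.mul_sum]
      _ = P := by simp [hu, hP, sq]
  have hle : P ^ 2 ≤ P := by
    calc P ^ 2 = (∑ k, u k i * u k i) ^ 2 := by simp only [hP, sq]
      _ ≤ ∑ j, (∑ k, u k i * u k j) ^ 2 :=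
          Finset.single_le_sum (f := fun j => (∑ k, u k i * u k j) ^ 2)
            (fun j _ => sq_nonneg _) (Finset.mem_univ i)
      _ = P := hnorm
  nlinarith

/-- The entries of `∑ k, u k (v k)ᵀ` lie in `[-1, 1]` when `u` and `v` are orthonormal families. -/
theorem abs_sum_mul_coord_le_one_of_orthonormal {ι ι' κ : Type*} [Fintype ι] [Fintype ι']
    [Fintype κ] [DecidableEq κ] (u : κ → ι → ℝ) (v : κ → ι' → ℝ)
    (hu : ∀ k l, (∑ i, u k i * u l i) = if k = l then 1 else 0)
    (hv : ∀ k l, (∑ j, v k j * v l j) = if k = l then 1 else 0) (i : ι) (j : ι') :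
    |∑ k, u k i * v k j| ≤ 1 := by
  rw [← sq_le_one_iff_abs_le_one]
  calc (∑ k, u k i * v k j) ^ 2 ≤ (∑ k, u k i ^ 2) * ∑ k, v k j ^ 2 :=
        Finset.sum_mul_sq_le_sq_mul_sq _ _ _
    _ ≤ 1 := mul_le_one₀ (sum_sq_coord_le_one_of_orthonormal u hu i)
        (Finset.sum_nonneg fun k _ => sq_nonneg _) (sum_sq_coord_le_one_of_orthonormal v hv j)


/-- **Lemma 5, right inequality: `‖X‖_* ≤ ‖X‖_{1,1}`.** If `X = ∑ k, σ k • u k (v k)ᵀ`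
with `σ k ≥ 0` and `{u k}`, `{v k}` orthonormal families, then
`∑ k, σ k ≤ ∑_{i,j} |X i j|`. -/
theorem nuclear_le_entrywise
    {n m r : ℕ} (X : Matrix (Fin n) (Fin m) ℝ)
    (σ : Fin r → ℝ) (hσ : ∀ k, 0 ≤ σ k)
    (u : Fin r → Fin n → ℝ) (v : Fin r → Fin m → ℝ)
    (hu : ∀ k l, (∑ i, u k i * u l i) = if k = l then 1 else 0)
    (hv : ∀ k l, (∑ j, v k j * v l j) = if k = l then 1 else 0)
    (hX : ∀ i j, X i j = ∑ k, σ k * u k i * v k j) :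
    (∑ k, σ k) ≤ ∑ i, ∑ j, |X i j| := by
  have hpair : ∑ i, ∑ j, X i j * ∑ l, u l i * v l j = ∑ k, σ k := by
    calc ∑ i, ∑ j, X i j * ∑ l, u l i * v l j
        = ∑ i, ∑ j, ∑ k, ∑ l, σ k * (u k i * u l i) * (v k j * v l j) := by
          refine Finset.sum_congr rfl fun i _ => Finset.sum_congr rfl fun j _ => ?_
          rw [hX, Finset.sum_mul_sum]
          exact Finset.sum_congr rfl fun k _ => Finset.sum_congr rfl fun l _ => by ring
      _ = ∑ i, ∑ k, ∑ l, σ k * (u k i * u l i) * ∑ j, v k j * v l j := by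
          refine Finset.sum_congr rfl fun i _ => ?_
          rw [Finset.sum_comm]
          refine Finset.sum_congr rfl fun k _ => ?_
          rw [Finset.sum_comm]
          simp only [Finset.mul_sum]
      _ = ∑ k, σ k * ∑ i, u k i * u k i := by
          simp only [hv, mul_ite, mul_one, mul_zero, Finset.sum_ite_eq, Finset.mem_univ, if_true]
          rw [Finset.sum_comm]
          simp only [Finset.mul_sum]
      _ = ∑ k, σ k := by simp [hu]
  rw [← hpair]
  refine Finset.sum_le_sum fun i _ => Finset.sum_le_sum fun j _ => ?_
  calc X i j * ∑ l, u l i * v l j ≤ |X i j| * |∑ l, u l i * v l j| := by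
        rw [← abs_mul]; exact le_abs_self _
    _ ≤ |X i j| := mul_le_of_le_one_right (abs_nonneg _)
        (abs_sum_mul_coord_le_one_of_orthonormal u v hu hv i j)
end

section
/- Let λ ∈ ℝ^n with |λ_1| ≥ |λ_2| ≥ … ≥ |λ_n| > 0 and let 0 < s ≤ n. Suppose k ∈ {0, 1, …, n−1} satisfies: (i) |λ_{k+1}| (s − k) ≤ Σ_{j=k+1}^n |λ_j|, and (ii) for every l with 0 ≤ l < k, |λ_{l+1}| (s − l) > Σ_{j=l+1}^n |λ_j|. Define p ∈ ℝ^n by p_i = 1 for i ≤ k and p_i = |λ_i|(s − k) / (Σ_{j=k+1}^n |λ_j|) for i > k. Then p is feasible (0 < p_i ≤ 1 for all i and Σ_{i=1}^n p_i = s) and p minimizes f(q) = Σ_{i=1}^n λ_i²/q_i over all feasible q; i.e., the ATOMO algorithm's output solves the variance-minimization problem. -/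
/-- The tangent line of `x ↦ a ^ 2 / x` at `p` lies below its graph. -/
theorem sq_div_sub_le_sq_div (a : ℝ) {p q : ℝ} (hp : 0 < p) (hq : 0 < q) :
    a ^ 2 / p - (a / p) ^ 2 * (q - p) ≤ a ^ 2 / q := by
  have h : a ^ 2 / q - (a ^ 2 / p - (a / p) ^ 2 * (q - p)) = (a / p) ^ 2 * (q - p) ^ 2 / q := by
    field_simp
    ring
  have : 0 ≤ (a / p) ^ 2 * (q - p) ^ 2 / q := by positivity
  linarith

/-- The Karush–Kuhn–Tucker conditions, with multiplier `μ` for the budget constraint, are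
sufficient for `p` to minimize `∑ i, a i ^ 2 / p i`. -/
theorem sum_sq_div_le_of_multiplier {ι : Type*} [Fintype ι] (a p q : ι → ℝ) (μ : ℝ)
    (hp : ∀ i, 0 < p i) (hq : ∀ i, 0 < q i) (hsum : ∑ i, p i = ∑ i, q i)
    (hμ : ∀ i, (a i / p i) ^ 2 * (q i - p i) ≤ μ * (q i - p i)) :
    ∑ i, a i ^ 2 / p i ≤ ∑ i, a i ^ 2 / q i := by
  have h : ∑ i, (a i ^ 2 / p i - μ * (q i - p i)) ≤ ∑ i, a i ^ 2 / q i :=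
    Finset.sum_le_sum fun i _ => by
      linarith [sq_div_sub_le_sq_div (a i) (hp i) (hq i), hμ i]
  rwa [Finset.sum_sub_distrib, ← Finset.mul_sum, Finset.sum_sub_distrib, hsum, sub_self,
    mul_zero, sub_zero] at h

/-- A tail sum splits into its first term and the next tail sum. -/
theorem Fin.sum_filter_le_eq_add_sum_filter_succ_le {M : Type*} [AddCommMonoid M] {n : ℕ}
    (f : Fin n → M) {l : ℕ} (hl : l < n) :
    ∑ j ∈ Finset.univ.filter (fun j : Fin n => l ≤ (j : ℕ)), f j =
      f ⟨l, hl⟩ + ∑ j ∈ Finset.univ.filter (fun j : Fin n => l + 1 ≤ (j : ℕ)), f j := by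
  have h : Finset.univ.filter (fun j : Fin n => l ≤ (j : ℕ)) =
      insert ⟨l, hl⟩ (Finset.univ.filter (fun j : Fin n => l + 1 ≤ (j : ℕ))) := by
    ext j
    simp only [Finset.mem_filter, Finset.mem_univ, true_and, Finset.mem_insert, Fin.ext_iff]
    omega
  rw [h, Finset.sum_insert (by simp)]


/-- **Correctness of the ATOMO algorithm.** Let `|λ 0| ≥ |λ 1| ≥ … ≥ |λ (n-1)| > 0` and
`0 < s ≤ n`. Suppose `k < n` is the first index such that
`|λ k| * (s - k) ≤ ∑_{j ≥ k} |λ j|` (condition (i)), i.e. for every `l < k` we have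
`|λ l| * (s - l) > ∑_{j ≥ l} |λ j|` (condition (ii)). Then the vector `p` with `p i = 1`
for `i < k` and `p i = |λ i| * (s - k) / ∑_{j ≥ k} |λ j|` for `i ≥ k` is feasible and
minimizes `f(q) = ∑ i, λ i ^ 2 / q i` over all feasible `q`. -/
theorem atomo_algorithm_optimal
    {n : ℕ} (lam : Fin n → ℝ)
    (hsorted : ∀ i j : Fin n, i ≤ j → |lam j| ≤ |lam i|)
    (hpos : ∀ i, 0 < |lam i|)
    (s : ℝ) (hs0 : 0 < s) (hsn : s ≤ n)
    (k : ℕ) (hk : k < n)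
    (hi : |lam ⟨k, hk⟩| * (s - k) ≤ ∑ j ∈ Finset.univ.filter (fun j : Fin n => k ≤ (j : ℕ)), |lam j|)
    (hii : ∀ l (hl : l < k),
      (∑ j ∈ Finset.univ.filter (fun j : Fin n => l ≤ (j : ℕ)), |lam j|)
        < |lam ⟨l, hl.trans hk⟩| * (s - l)) :
    (∀ i : Fin n,
        0 < (if (i : ℕ) < k then 1 else
          |lam i| * (s - k) / ∑ j ∈ Finset.univ.filter (fun j : Fin n => k ≤ (j : ℕ)), |lam j|)
        ∧ (if (i : ℕ) < k then 1 else
          |lam i| * (s - k) / ∑ j ∈ Finset.univ.filter (fun j : Fin n => k ≤ (j : ℕ)), |lam j|) ≤ 1)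
    ∧ (∑ i : Fin n, (if (i : ℕ) < k then 1 else
          |lam i| * (s - k) / ∑ j ∈ Finset.univ.filter (fun j : Fin n => k ≤ (j : ℕ)), |lam j|)) = s
    ∧ ∀ q : Fin n → ℝ, (∀ i, 0 < q i ∧ q i ≤ 1) → (∑ i, q i) = s →
        (∑ i : Fin n, (lam i) ^ 2 / (if (i : ℕ) < k then 1 else
          |lam i| * (s - k) / ∑ j ∈ Finset.univ.filter (fun j : Fin n => k ≤ (j : ℕ)), |lam j|))
          ≤ ∑ i, (lam i) ^ 2 / q i := by
  set S := ∑ j ∈ Finset.univ.filter (fun j : Fin n => k ≤ (j : ℕ)), |lam j| with hS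
  have hS0 : 0 < S := Finset.sum_pos (fun j _ => hpos j) ⟨⟨k, hk⟩, by simp⟩
  have htail : ∀ l (hl : l < k), k = l + 1 → S < |lam ⟨l, hl.trans hk⟩| * (s - k) := by
    rintro l hl rfl
    have h := hii l hl
    rw [Fin.sum_filter_le_eq_add_sum_filter_succ_le _ (hl.trans hk), ← hS] at h
    push_cast
    linarith
  have hsk : 0 < s - k := by
    rcases Nat.eq_zero_or_pos k with h0 | h0
    · simpa [h0] using hs0
    · exact pos_of_mul_pos_right (hS0.trans (htail (k - 1) (by omega) (by omega))) (abs_nonneg _)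
  have hhead : ∀ i : Fin n, (i : ℕ) < k → S / (s - k) ≤ |lam i| := by
    intro i hik
    rw [div_le_iff₀ hsk]
    refine (htail (k - 1) (by omega) (by omega)).le.trans ?_
    exact mul_le_mul_of_nonneg_right (hsorted _ _ (Fin.le_def.2 (Nat.le_sub_one_of_lt hik))) hsk.le
  set p : Fin n → ℝ := fun i => if (i : ℕ) < k then 1 else |lam i| * (s - k) / S with hp
  have hp0 : ∀ i, 0 < p i := by
    intro i
    have := hpos i
    simp only [hp]
    split_ifs <;> positivity
  have hp1 : ∀ i, p i ≤ 1 := by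
    intro i
    simp only [hp]
    split_ifs with h
    · exact le_rfl
    · rw [div_le_one hS0]
      exact (mul_le_mul_of_nonneg_right
        (hsorted ⟨k, hk⟩ i (Fin.le_def.2 (not_lt.1 h))) hsk.le).trans hi
  have hps : ∑ i, p i = s := by
    have hcard : (Finset.univ.filter (fun i : Fin n => (i : ℕ) < k)).card = k := by
      rw [Fin.card_filter_val_lt, min_eq_right hk.le]
    simp only [hp, Finset.sum_ite, Finset.sum_const, hcard, not_lt, nsmul_eq_mul, mul_one]
    rw [← Finset.sum_div, ← Finset.sum_mul, ← hS, mul_div_cancel_left₀ _ hS0.ne']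
    ring
  refine ⟨fun i => ⟨hp0 i, hp1 i⟩, hps, fun q hq hqs => ?_⟩
  refine sum_sq_div_le_of_multiplier lam p q ((S / (s - k)) ^ 2) hp0 (fun i => (hq i).1)
    (hps.trans hqs.symm) fun i => ?_
  by_cases h : (i : ℕ) < k
  · have hpi : p i = 1 := if_pos h
    rw [hpi, div_one, ← sq_abs (lam i)]
    exact mul_le_mul_of_nonpos_right (pow_le_pow_left₀ (by positivity) (hhead i h) 2)
      (sub_nonpos.2 (hq i).2)
  · have hpi : p i = |lam i| * (s - k) / S := if_neg h
    have hlam := (hpos i).ne'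
    have hratio : |lam i| / p i = S / (s - k) := by
      rw [hpi]
      field_simp
    rw [← hratio, div_pow, div_pow, sq_abs]
end

section
/- Let n ≥ 1, let λ ∈ ℝ^n, let s > 0, and let q ∈ ℝ^n be feasible (0 < q_i ≤ 1 for all i, Σ_{i=1}^n q_i = s). Let A ⊆ {2, …, n} be nonempty with Σ_{j∈A} |λ_j| > 0, and set s_A = Σ_{i∈A} q_i. Suppose: (1) for all i ∈ A, |λ_i| (s_A + q_1 − 1) ≤ Σ_{j∈A} |λ_j| (i.e., the restriction of λ to A is (s_A + q_1 − 1)-balanced), and (2) |λ_1| (s_A + q_1 − 1) > Σ_{j∈A} |λ_j|. Then there exists a feasible p ∈ ℝ^n (0 < p_i ≤ 1 for all i, Σ_{i=1}^n p_i = s) with p_1 = 1 and Σ_{i=1}^n λ_i²/p_i ≤ Σ_{i=1}^n λ_i²/q_i. -/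
/-- A strict inequality survives a small convex perturbation of its smaller side. -/
lemma exists_convex_combination_le {x y : ℝ} (h : x < y) (z : ℝ) :
    ∃ ε : ℝ, 0 < ε ∧ ε < 1 ∧ (1 - ε) * x + ε * z ≤ y := by
  have hM : 0 < |z - x| + 1 := by positivity
  have hd : 0 < y - x := sub_pos.2 h
  have hε : 0 < (y - x) / (y - x + (|z - x| + 1)) := by positivity
  refine ⟨(y - x) / (y - x + (|z - x| + 1)), hε, ?_, ?_⟩
  · rw [div_lt_one (by positivity)]
    linarith
  · have hz : z - x ≤ y - x + (|z - x| + 1) := by linarith [le_abs_self (z - x)]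
    have hmul := mul_le_mul_of_nonneg_left hz hε.le
    rw [div_mul_cancel₀ _ (by positivity)] at hmul
    linarith

/-- Convexity of `x ↦ c / x` on the positive reals. -/
lemma div_convex_combination_le {a b c ε : ℝ} (ha : 0 < a) (hb : 0 < b) (hc : 0 ≤ c)
    (hε0 : 0 < ε) (hε1 : ε < 1) :
    c / ((1 - ε) * a + ε * b) ≤ (1 - ε) * (c / a) + ε * (c / b) := by
  have h1 : 0 < 1 - ε := sub_pos.2 hε1
  have hpos : 0 < (1 - ε) * a + ε * b := by positivity
  have key : (1 - ε) * (c / a) + ε * (c / b) - c / ((1 - ε) * a + ε * b) =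
      c * (ε * (1 - ε) * (a - b) ^ 2) / (a * b * ((1 - ε) * a + ε * b)) := by
    field_simp
    ring
  have : 0 ≤ c * (ε * (1 - ε) * (a - b) ^ 2) / (a * b * ((1 - ε) * a + ε * b)) := by
    positivity
  linarith

/-- Perturbing the optimal allocation `|l i| * T / ∑ |l j|` towards `q` keeps it positive and
bounded by one, and costs arbitrarily little. -/
lemma exists_allocation_of_balanced {ι : Type*} (A : Finset ι) (l q : ι → ℝ) {T C : ℝ}
    (hT : 0 < T) (hTq : T ≤ ∑ i ∈ A, q i) (hq : ∀ i ∈ A, 0 < q i ∧ q i ≤ 1)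
    (hl : 0 < ∑ i ∈ A, |l i|) (hbal : ∀ i ∈ A, |l i| * T ≤ ∑ j ∈ A, |l j|)
    (hC : (∑ i ∈ A, |l i|) ^ 2 / T < C) :
    ∃ r : ι → ℝ, (∀ i ∈ A, 0 < r i ∧ r i ≤ 1) ∧ ∑ i ∈ A, r i = T ∧
      ∑ i ∈ A, l i ^ 2 / r i ≤ C := by
  set L := ∑ i ∈ A, |l i| with hL
  set S := ∑ i ∈ A, q i with hS
  have hSpos : 0 < S := hT.trans_le hTq
  obtain ⟨ε, hε0, hε1, hε⟩ :=
    exists_convex_combination_le hC (∑ i ∈ A, l i ^ 2 / (q i * T / S))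
  have h1ε : 0 < 1 - ε := sub_pos.2 hε1
  have hb : ∀ i ∈ A, 0 < q i * T / S := fun i hi => by
    have := (hq i hi).1
    positivity
  refine ⟨fun i => (1 - ε) * (|l i| * T / L) + ε * (q i * T / S),
    fun i hi => ⟨?_, ?_⟩, ?_, ?_⟩
  · have := mul_pos hε0 (hb i hi)
    have : 0 ≤ (1 - ε) * (|l i| * T / L) := by positivity
    dsimp only
    linarith
  · have ha1 : |l i| * T / L ≤ 1 := (div_le_one hl).2 (hbal i hi)
    have hb1 : q i * T / S ≤ 1 := by
      rw [div_le_one hSpos]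
      nlinarith [(hq i hi).1, (hq i hi).2]
    dsimp only
    nlinarith
  · rw [Finset.sum_add_distrib, ← Finset.mul_sum, ← Finset.mul_sum, ← Finset.sum_div,
      ← Finset.sum_div, ← Finset.sum_mul, ← Finset.sum_mul, ← hL, ← hS]
    field_simp
    ring
  · have hsum : ∑ i ∈ A, l i ^ 2 / (|l i| * T / L) = L ^ 2 / T := by
      have hterm : ∀ i ∈ A, l i ^ 2 / (|l i| * T / L) = |l i| * (L / T) := fun i _ => by
        rcases eq_or_ne (l i) 0 with h0 | h0
        · simp [h0]
        · have := abs_pos.2 h0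
          rw [← sq_abs]
          field_simp
      rw [Finset.sum_congr rfl hterm, ← Finset.sum_mul, ← hL]
      ring
    refine le_trans ?_ hε
    rw [← hsum, Finset.mul_sum, Finset.mul_sum, ← Finset.sum_add_distrib]
    refine Finset.sum_le_sum fun i hi => ?_
    rcases eq_or_ne (l i) 0 with h0 | h0
    · simp [h0]
    · have := abs_pos.2 h0
      exact div_convex_combination_le (by positivity) (hb i hi) (sq_nonneg _) hε0 hε1

/-- **Appendix Lemma (aux1).** Let `q` be feasible for budget `s` (`0 < q i ≤ 1`,
`∑ i, q i = s`) and let `A` be a nonempty set of indices not containing the first index,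
with `∑_{j ∈ A} |λ j| > 0` and `s_A = ∑_{i ∈ A} q i`. If (1) `λ` restricted to `A` is
`(s_A + q 0 - 1)`-balanced, and (2) `|λ 0| * (s_A + q 0 - 1) > ∑_{j ∈ A} |λ j|`, then
there is a feasible `p` with `p 0 = 1` and `∑ i, λ i ^ 2 / p i ≤ ∑ i, λ i ^ 2 / q i`. -/
theorem atomo_aux1
    {n : ℕ} (hn : 0 < n) (lam q : Fin n → ℝ) (s : ℝ) (hs : 0 < s)
    (hq : ∀ i, 0 < q i ∧ q i ≤ 1) (hqsum : ∑ i, q i = s)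
    (A : Finset (Fin n)) (hA0 : (⟨0, hn⟩ : Fin n) ∉ A) (hAne : A.Nonempty)
    (hApos : 0 < ∑ j ∈ A, |lam j|)
    (h1 : ∀ i ∈ A, |lam i| * ((∑ j ∈ A, q j) + q ⟨0, hn⟩ - 1) ≤ ∑ j ∈ A, |lam j|)
    (h2 : (∑ j ∈ A, |lam j|) < |lam ⟨0, hn⟩| * ((∑ j ∈ A, q j) + q ⟨0, hn⟩ - 1)) :
    ∃ p : Fin n → ℝ, (∀ i, 0 < p i ∧ p i ≤ 1) ∧ (∑ i, p i) = s ∧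
      p ⟨0, hn⟩ = 1 ∧ (∑ i, (lam i) ^ 2 / p i) ≤ ∑ i, (lam i) ^ 2 / q i := by
  classical
  set z : Fin n := ⟨0, hn⟩
  obtain hq1 | hq1 := (hq z).2.eq_or_lt
  · exact ⟨q, hq, hqsum, hq1, le_rfl⟩
  have hqz := (hq z).1
  set L := ∑ j ∈ A, |lam j| with hL
  set S := ∑ j ∈ A, q j with hS
  set T := S + q z - 1 with hTdef
  have hT : 0 < T := pos_of_mul_pos_right (hApos.trans h2) (abs_nonneg _)
  have hTS : T ≤ S := by linarith
  have hSpos : 0 < S := hT.trans_le hTS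
  have hCS : L ^ 2 / S ≤ ∑ i ∈ A, lam i ^ 2 / q i := by
    simpa only [sq_abs] using
      Finset.sq_sum_div_le_sum_sq_div A (fun i => |lam i|) fun i _ => (hq i).1
  have hlt : L ^ 2 / T < lam z ^ 2 / q z - lam z ^ 2 + ∑ i ∈ A, lam i ^ 2 / q i := by
    have hsq : L ^ 2 < lam z ^ 2 * T ^ 2 := by
      rw [← sq_abs (lam z), ← mul_pow]
      exact pow_lt_pow_left₀ h2 hApos.le two_ne_zero
    have hmain : L ^ 2 * q z < lam z ^ 2 * (T * S) := by
      have hbound : lam z ^ 2 * T ^ 2 ≤ lam z ^ 2 * (T * S) :=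
        mul_le_mul_of_nonneg_left (by nlinarith) (sq_nonneg _)
      nlinarith [sq_nonneg L]
    have hdiff : lam z ^ 2 / q z - lam z ^ 2 + L ^ 2 / S - L ^ 2 / T =
        (1 - q z) * (lam z ^ 2 * (T * S) - L ^ 2 * q z) / (q z * T * S) := by
      have hq' : q z = T - S + 1 := by linarith
      have hne : T - S + 1 ≠ 0 := hq' ▸ hqz.ne'
      rw [hq']
      field_simp
      ring
    have : 0 < (1 - q z) * (lam z ^ 2 * (T * S) - L ^ 2 * q z) / (q z * T * S) :=
      div_pos (mul_pos (sub_pos.2 hq1) (sub_pos.2 hmain)) (by positivity)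
    linarith
  obtain ⟨r, hr, hrsum, hrle⟩ :=
    exists_allocation_of_balanced A lam q hT hTS (fun i _ => hq i) hApos h1 hlt
  let p : Fin n → ℝ := fun i => if i = z then 1 else if i ∈ A then r i else q i
  have hpz : p z = 1 := if_pos rfl
  have hpA : ∀ i ∈ A, p i = r i := fun i hi => by
    simp only [p, if_neg (ne_of_mem_of_not_mem hi hA0), if_pos hi]
  have hpc : ∀ i ∈ (insert z A)ᶜ, p i = q i := fun i hi => by
    rw [Finset.mem_compl, Finset.mem_insert, not_or] at hi
    simp only [p, if_neg hi.1, if_neg hi.2]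
  have hsplit : ∀ f : Fin n → ℝ,
      ∑ i, f i = f z + ∑ i ∈ A, f i + ∑ i ∈ (insert z A)ᶜ, f i := fun f => by
    rw [← Finset.sum_add_sum_compl (insert z A), Finset.sum_insert hA0]
  refine ⟨p, fun i => ?_, ?_, hpz, ?_⟩
  · by_cases hi : i = z
    · simp [hi, hpz]
    · by_cases hiA : i ∈ A
      · rw [hpA i hiA]
        exact hr i hiA
      · rw [hpc i (by simp [hi, hiA])]
        exact hq i
  · rw [← hqsum, hsplit p, hsplit q, hpz, Finset.sum_congr rfl hpA, Finset.sum_congr rfl hpc,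
      hrsum]
    linarith
  · rw [hsplit, hsplit fun i => lam i ^ 2 / q i, hpz,
      Finset.sum_congr rfl fun i hi => congrArg (lam i ^ 2 / ·) (hpA i hi),
      Finset.sum_congr rfl fun i hi => congrArg (lam i ^ 2 / ·) (hpc i hi)]
    linarith
end
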